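/- arXiv:1501.04039 — 2 statements merged into one kernel-verified Lean document; each statement's English description precedes it below -/
import Mathlib

section
/- Let 𝒜 be a supersolvable line arrangement in ℙ² over an arbitrary field. Then every singular point D ∈ Sing(𝒜) of maximum multiplicity, i.e. with m(D,𝒜) = m(𝒜), is a modular point. -/
open scoped Classical

/-- A point of the projective plane over `K`. -/
abbrev Pt (K : Type*) [Field K] := Projectivization K (Fin 3 → K)

/-- A (candidate) line arrangement: a finite set of linear subspaces of `K³`. -/
abbrev Arr (K : Type*) [Field K] := Finset (Submodule K (Fin 3 → K))

/-- Every member of `A` is a projective line, i.e. a 2-dimensional linear subspace of `K³`. -/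
def IsLineArr {K : Type*} [Field K] (A : Arr K) : Prop :=
  ∀ L ∈ A, Module.finrank K L = 2

/-- The multiplicity `m(P, A)`: the number of lines of `A` passing through `P`. -/
noncomputable def multAt {K : Type*} [Field K] (A : Arr K) (P : Pt K) : ℕ :=
  (A.filter fun L => P.submodule ≤ L).card

/-- `Sing(A)`: the set of points lying on at least two lines of `A`. -/
def SingSet {K : Type*} [Field K] (A : Arr K) : Set (Pt K) :=
  {P | 2 ≤ multAt A P}

/-- `Sing₂(A)`: the set of simple points, i.e. singular points of multiplicity exactly 2. -/
def Sing2Set {K : Type*} [Field K] (A : Arr K) : Set (Pt K) :=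
  {P | multAt A P = 2}

/-- `m(A)`: the maximum multiplicity of a singular point of `A`. -/
noncomputable def maxMult {K : Type*} [Field K] (A : Arr K) : ℕ :=
  sSup (multAt A '' SingSet A)

/-- `P` is a modular point of `A`: it is singular, and for every other singular point `Q`
the line through `P` and `Q` belongs to `A`. -/
def IsModular {K : Type*} [Field K] (A : Arr K) (P : Pt K) : Prop :=
  P ∈ SingSet A ∧ ∀ Q ∈ SingSet A, Q ≠ P → (P.submodule ⊔ Q.submodule) ∈ A

/-- `A` is supersolvable: it has a modular point. -/
def Supersolvable {K : Type*} [Field K] (A : Arr K) : Prop :=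
  ∃ P, IsModular A P

/-- `A` has full rank (rank 3): its lines have no common point. -/
def FullRank {K : Type*} [Field K] (A : Arr K) : Prop :=
  (⨅ L ∈ A, L) = ⊥

/-- The line through two distinct points of a projective line is that line. -/
theorem sup_submodule_eq_line {K : Type*} [Field K] {P Q : Pt K} (hPQ : P ≠ Q)
    {L : Submodule K (Fin 3 → K)} (hL : Module.finrank K L = 2)
    (hP : P.submodule ≤ L) (hQ : Q.submodule ≤ L) : P.submodule ⊔ Q.submodule = L := by
  have hle : P.submodule ⊔ Q.submodule ≤ L := sup_le hP hQ
  refine Submodule.eq_of_le_of_finrank_le hle ?_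
  by_contra! hlt
  have h1 : Module.finrank K (P.submodule ⊔ Q.submodule : Submodule K (Fin 3 → K)) ≤ 1 := by
    omega
  have e1 : P.submodule = P.submodule ⊔ Q.submodule :=
    Submodule.eq_of_le_of_finrank_le le_sup_left (by rw [P.finrank_submodule]; exact h1)
  have e2 : Q.submodule = P.submodule ⊔ Q.submodule :=
    Submodule.eq_of_le_of_finrank_le le_sup_right (by rw [Q.finrank_submodule]; exact h1)
  exact hPQ (Projectivization.submodule_injective (e1.trans e2.symm))

/-- Two distinct projective lines meet in a point. -/
theorem exists_submodule_eq_inf {K : Type*} [Field K] {L M : Submodule K (Fin 3 → K)}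
    (hL : Module.finrank K L = 2) (hM : Module.finrank K M = 2) (hLM : L ≠ M) :
    ∃ R : Pt K, R.submodule = L ⊓ M := by
  have hsum := Submodule.finrank_sup_add_finrank_inf_eq L M
  have hsup : Module.finrank K (L ⊔ M : Submodule K (Fin 3 → K)) ≤ 3 := by
    simpa using Submodule.finrank_le (L ⊔ M)
  have hinf : Module.finrank K (L ⊓ M : Submodule K (Fin 3 → K)) ≤ 1 := by
    by_contra! h
    have e1 : L ⊓ M = L := Submodule.eq_of_le_of_finrank_le inf_le_left (by omega)
    have e2 : L ⊓ M = M := Submodule.eq_of_le_of_finrank_le inf_le_right (by omega)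
    exact hLM (e1.symm.trans e2)
  exact ⟨Projectivization.mk'' (L ⊓ M) (by omega), Projectivization.submodule_mk'' _ _⟩

/-- A point on two distinct lines of an arrangement is singular. -/
theorem mem_singSet_of_le {K : Type*} [Field K] {A : Arr K} {P : Pt K}
    {L M : Submodule K (Fin 3 → K)} (hL : L ∈ A) (hM : M ∈ A) (hLM : L ≠ M)
    (hPL : P.submodule ≤ L) (hPM : P.submodule ≤ M) : P ∈ SingSet A :=
  Finset.one_lt_card.2
    ⟨L, Finset.mem_filter.2 ⟨hL, hPL⟩, M, Finset.mem_filter.2 ⟨hM, hPM⟩, hLM⟩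

/-- Through a singular point passes a line of the arrangement avoiding any other given point. -/
theorem exists_line_avoiding {K : Type*} [Field K] {A : Arr K} (hA : IsLineArr A) {P Q : Pt K}
    (hPQ : P ≠ Q) (hQ : Q ∈ SingSet A) :
    ∃ M ∈ A, Q.submodule ≤ M ∧ ¬ P.submodule ≤ M := by
  obtain ⟨L, hL, M, hM, hLM⟩ := Finset.one_lt_card.1 (show 1 < multAt A Q from hQ)
  rw [Finset.mem_filter] at hL hM
  by_contra! h
  exact hLM ((sup_submodule_eq_line hPQ (hA L hL.1) (h L hL.1 hL.2) hL.2).symm.trans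
    (sup_submodule_eq_line hPQ (hA M hM.1) (h M hM.1 hM.2) hM.2))

/-- Projecting from a point `P` off the line `M` is injective on the subspaces of `M`. -/
theorem sup_inf_eq_of_not_le {K : Type*} [Field K] {P : Pt K} {M H : Submodule K (Fin 3 → K)}
    (hP : ¬ P.submodule ≤ M) (hH : H ≤ M) : (P.submodule ⊔ H) ⊓ M = H := by
  have hbot : P.submodule ⊓ M = ⊥ := by
    by_contra hne
    have hpos := Submodule.one_le_finrank_iff.2 hne
    exact hP (inf_eq_left.1 (Submodule.eq_of_le_of_finrank_le inf_le_left
      (by rw [P.finrank_submodule]; exact hpos)))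
  rw [sup_comm, sup_inf_assoc_of_le _ hH, hbot, sup_bot_eq]

theorem multAt_le_maxMult {K : Type*} [Field K] (A : Arr K) {P : Pt K} (hP : P ∈ SingSet A) :
    multAt A P ≤ maxMult A := by
  refine le_csSup ⟨A.card, ?_⟩ ⟨P, hP, rfl⟩
  rintro _ ⟨Q, -, rfl⟩
  exact Finset.card_filter_le _ _

/-- If `P` is modular and a singular point `Q` is not joined to `D` by a line of `A`, then `P` has
larger multiplicity than `D`. -/
theorem multAt_lt_of_isModular {K : Type*} [Field K] {A : Arr K} (hA : IsLineArr A)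
    {P D Q : Pt K} (hP : IsModular A P) (hQ : Q ∈ SingSet A) (hPQ : P ≠ Q) (hDQ : D ≠ Q)
    (hDQA : D.submodule ⊔ Q.submodule ∉ A) : multAt A D < multAt A P := by
  obtain ⟨M, hMA, hQM, hPM⟩ := exists_line_avoiding hA hPQ hQ
  have not_both : ∀ L ∈ A, D.submodule ≤ L → ¬ Q.submodule ≤ L := fun L hL h1 h2 =>
    hDQA (by rwa [sup_submodule_eq_line hDQ (hA L hL) h1 h2])
  have hDM : ¬ D.submodule ≤ M := fun h => not_both M hMA h hQM
  have meet : ∀ L ∈ A, D.submodule ≤ L → ∃ R : Pt K, R.submodule = L ⊓ M := fun L hL hDL =>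
    exists_submodule_eq_inf (hA L hL) (hA M hMA) (by rintro rfl; exact hDM hDL)
  set S := A.filter fun L => D.submodule ≤ L with hS
  let f : Submodule K (Fin 3 → K) → Submodule K (Fin 3 → K) := fun L => P.submodule ⊔ L ⊓ M
  have hinj : Set.InjOn f S := by
    intro L hL L' hL' he
    obtain ⟨hLA, hDL⟩ := Finset.mem_filter.1 hL
    obtain ⟨hLA', hDL'⟩ := Finset.mem_filter.1 hL'
    have hmeet : L ⊓ M = L' ⊓ M := by
      rw [← sup_inf_eq_of_not_le hPM (inf_le_right : L ⊓ M ≤ M),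
        ← sup_inf_eq_of_not_le hPM (inf_le_right : L' ⊓ M ≤ M)]
      exact congrArg (· ⊓ M) he
    obtain ⟨R, hR⟩ := meet L hLA hDL
    have hDR : D ≠ R := by
      rintro rfl
      exact hDM (hR.le.trans inf_le_right)
    exact (sup_submodule_eq_line hDR (hA L hLA) hDL (hR.le.trans inf_le_left)).symm.trans
      (sup_submodule_eq_line hDR (hA L' hLA') hDL' ((hR.trans hmeet).le.trans inf_le_left))
  have hnot : P.submodule ⊔ Q.submodule ∉ S.image f := by
    intro h
    obtain ⟨L, hL, he⟩ := Finset.mem_image.1 h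
    obtain ⟨hLA, hDL⟩ := Finset.mem_filter.1 hL
    have hQL : L ⊓ M = Q.submodule := by
      rw [← sup_inf_eq_of_not_le hPM (inf_le_right : L ⊓ M ≤ M),
        ← sup_inf_eq_of_not_le hPM hQM]
      exact congrArg (· ⊓ M) he
    exact not_both L hLA hDL (hQL.ge.trans inf_le_left)
  have hsub : insert (P.submodule ⊔ Q.submodule) (S.image f) ⊆
      A.filter fun L => P.submodule ≤ L := by
    intro N hN
    rcases Finset.mem_insert.1 hN with rfl | hN
    · exact Finset.mem_filter.2 ⟨hP.2 Q hQ hPQ.symm, le_sup_left⟩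
    · obtain ⟨L, hL, rfl⟩ := Finset.mem_image.1 hN
      obtain ⟨hLA, hDL⟩ := Finset.mem_filter.1 hL
      obtain ⟨R, hR⟩ := meet L hLA hDL
      have hRP : R ≠ P := by
        rintro rfl
        exact hPM (hR.le.trans inf_le_right)
      have hRs : R ∈ SingSet A := mem_singSet_of_le hLA hMA (by rintro rfl; exact hDM hDL)
        (hR.le.trans inf_le_left) (hR.le.trans inf_le_right)
      refine Finset.mem_filter.2 ⟨?_, le_sup_left⟩
      have hPR := hP.2 R hRs hRP
      rwa [hR] at hPR
  have hcard := Finset.card_le_card hsub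
  rw [Finset.card_insert_of_notMem hnot, Finset.card_image_of_injOn hinj] at hcard
  exact hcard

/-- In a supersolvable line arrangement, every singular point of maximum
multiplicity is modular. -/
theorem max_mult_is_modular {K : Type*} [Field K] (A : Arr K) (hA : IsLineArr A)
    (hss : Supersolvable A) (D : Pt K) (hD : D ∈ SingSet A)
    (hDmax : multAt A D = maxMult A) :
    IsModular A D := by
  obtain ⟨P, hP⟩ := hss
  refine ⟨hD, fun Q hQ hQD => ?_⟩
  by_contra hDQA
  have hPQ : P ≠ Q := by
    rintro rfl
    exact hDQA (sup_comm P.submodule D.submodule ▸ hP.2 D hD hQD.symm)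
  have hlt := multAt_lt_of_isModular hA hP hQ hPQ hQD.symm hDQA
  have hle := multAt_le_maxMult A hP.1
  omega
end

section
/- Let m ≥ 3 and let 𝒜_{2m} be the Böröczky arrangement of 2m lines in ℙ²(ℝ): the lines L_j defined by cos(2πj/m)·x + sin(2πj/m)·y + z = 0 for 0 ≤ j ≤ m−1, together with the lines L′_k defined by sin(πk/m)·x − cos(πk/m)·y = 0 for 0 ≤ k ≤ m−1. Then each line L_j contains exactly one simple point of 𝒜_{2m}, namely the intersection point of L_j and L′_{2j mod m}; consequently |Sing₂(𝒜_{2m})| = m = |𝒜_{2m}|/2. -/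
open scoped Classical

/-- The projective line in `ℙ²(ℝ)` with equation `a·x + b·y + c·z = 0`. -/
noncomputable def lineOf (a b c : ℝ) : Submodule ℝ (Fin 3 → ℝ) :=
  LinearMap.ker
    ((a • LinearMap.proj 0 + b • LinearMap.proj 1 + c • LinearMap.proj 2 :
      (Fin 3 → ℝ) →ₗ[ℝ] ℝ))

/-- The line `L_j : cos(2πj/m)·x + sin(2πj/m)·y + z = 0`. -/
noncomputable def lineL (m j : ℕ) : Submodule ℝ (Fin 3 → ℝ) :=
  lineOf (Real.cos (2 * Real.pi * j / m)) (Real.sin (2 * Real.pi * j / m)) 1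

/-- The line `L'_k : sin(πk/m)·x − cos(πk/m)·y = 0`. -/
noncomputable def lineL' (m k : ℕ) : Submodule ℝ (Fin 3 → ℝ) :=
  lineOf (Real.sin (Real.pi * k / m)) (-Real.cos (Real.pi * k / m)) 0

/-- The Böröczky arrangement `𝒜_{2m}` of `2m` lines. -/
noncomputable def boro (m : ℕ) : Arr ℝ :=
  ((Finset.range m).image fun j => lineL m j) ∪ ((Finset.range m).image fun k => lineL' m k)

/-- The point `P = [0:0:1]`. -/
noncomputable def boroP : Pt ℝ :=
  Projectivization.mk ℝ ![0, 0, 1] (fun h => by simpa using congrFun h 2)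

open Real in
theorem cos_mul_add_sin_mul_eq_one_iff {m i j : ℕ} (hi : i < m) (hj : j < m) :
    cos (2 * π * i / m) * cos (2 * π * j / m) + sin (2 * π * i / m) * sin (2 * π * j / m) = 1 ↔
      i = j := by
  have hm : (m : ℝ) ≠ 0 := by
    have : m ≠ 0 := by omega
    exact_mod_cast this
  rw [← cos_sub, cos_eq_one_iff]
  constructor
  · rintro ⟨n, hn⟩
    field_simp at hn
    have h : (m : ℤ) * n = i - j := by
      have := mul_left_cancel₀ pi_ne_zero
        (show π * ((m : ℝ) * n) = π * ((i : ℝ) - j) by linear_combination π * hn)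
      exact_mod_cast this
    have h1 : (m : ℤ) ∣ (i : ℤ) - j := ⟨n, h.symm⟩
    have h2 : (i : ℤ) - j = 0 := Int.eq_zero_of_abs_lt_dvd h1 (by rw [abs_lt]; omega)
    omega
  · rintro rfl
    exact ⟨0, by simp⟩

open Real in
theorem sin_mul_cos_sub_eq_zero_iff {m : ℕ} (hm : m ≠ 0) (k l : ℕ) :
    sin (π * k / m) * cos (π * l / m) - cos (π * k / m) * sin (π * l / m) = 0 ↔
      k ≡ l [MOD m] := by
  have hm' : (m : ℝ) ≠ 0 := by exact_mod_cast hm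
  rw [← sin_sub, sin_eq_zero_iff, Nat.ModEq.comm, Nat.modEq_iff_dvd]
  constructor
  · rintro ⟨n, hn⟩
    field_simp at hn
    refine ⟨n, ?_⟩
    have h : (k : ℝ) - l = m * n := by linear_combination -hn
    exact_mod_cast h
  · rintro ⟨n, hn⟩
    refine ⟨n, ?_⟩
    have h : (k : ℝ) - l = m * n := by exact_mod_cast hn
    field_simp
    linear_combination -h

theorem submodule_le_iff_rep_mem {K : Type*} [Field K] (P : Pt K)
    (L : Submodule K (Fin 3 → K)) : P.submodule ≤ L ↔ P.rep ∈ L := by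
  rw [Projectivization.submodule_eq, Submodule.span_singleton_le_iff_mem]

theorem mem_lineL {m j : ℕ} {v : Fin 3 → ℝ} : v ∈ lineL m j ↔
    Real.cos (2 * Real.pi * j / m) * v 0 + Real.sin (2 * Real.pi * j / m) * v 1 + v 2 = 0 := by
  simp [lineL, lineOf]

theorem mem_lineL' {m k : ℕ} {v : Fin 3 → ℝ} : v ∈ lineL' m k ↔
    Real.sin (Real.pi * k / m) * v 0 - Real.cos (Real.pi * k / m) * v 1 = 0 := by
  simp [lineL', lineOf, sub_eq_add_neg]

/-- Coordinates of the point where `L_j` meets `L'_{2j}`. -/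
noncomputable def tangencyVec (m j : ℕ) : Fin 3 → ℝ :=
  ![Real.cos (2 * Real.pi * j / m), Real.sin (2 * Real.pi * j / m), -1]

theorem tangencyVec_ne_zero (m j : ℕ) : tangencyVec m j ≠ 0 := fun h => by
  simpa [tangencyVec] using congrFun h 2

/-- The point where `L_j` meets `L'_{2j}`. -/
noncomputable def tangencyPt (m j : ℕ) : Pt ℝ :=
  Projectivization.mk ℝ (tangencyVec m j) (tangencyVec_ne_zero m j)

theorem tangencyVec_mem_lineL_iff {m i j : ℕ} (hi : i < m) (hj : j < m) :
    tangencyVec m j ∈ lineL m i ↔ i = j := by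
  rw [mem_lineL, ← cos_mul_add_sin_mul_eq_one_iff hi hj]
  simp [tangencyVec, ← sub_eq_add_neg, sub_eq_zero]

theorem tangencyVec_mem_lineL'_iff {m : ℕ} (hm : m ≠ 0) (k j : ℕ) :
    tangencyVec m j ∈ lineL' m k ↔ k ≡ 2 * j [MOD m] := by
  rw [mem_lineL', ← sin_mul_cos_sub_eq_zero_iff hm]
  have h : Real.pi * ((2 * j : ℕ) : ℝ) / m = 2 * Real.pi * j / m := by push_cast; ring
  rw [h]
  simp [tangencyVec]

theorem tangencyPt_le_iff (m j : ℕ) (L : Submodule ℝ (Fin 3 → ℝ)) :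
    (tangencyPt m j).submodule ≤ L ↔ tangencyVec m j ∈ L := by
  rw [tangencyPt, Projectivization.submodule_mk, Submodule.span_singleton_le_iff_mem]

theorem lineL_injOn (m : ℕ) : Set.InjOn (lineL m) (Finset.range m) := by
  intro i hi j hj h
  simp only [Finset.coe_range, Set.mem_Iio] at hi hj
  rw [← tangencyVec_mem_lineL_iff hi hj, h, tangencyVec_mem_lineL_iff hj hj]

theorem lineL'_injOn {m : ℕ} (hm : m ≠ 0) : Set.InjOn (lineL' m) (Finset.range m) := by
  intro k hk l hl h
  simp only [Finset.coe_range, Set.mem_Iio] at hk hl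
  have key : ∀ k, ![Real.cos (Real.pi * l / m), Real.sin (Real.pi * l / m), 0] ∈ lineL' m k ↔
      k ≡ l [MOD m] := fun k => by
    rw [mem_lineL', ← sin_mul_cos_sub_eq_zero_iff hm]
    simp
  exact Nat.ModEq.eq_of_lt_of_lt ((key k).1 (h ▸ (key l).2 rfl)) hk hl

theorem disjoint_image_lineL_lineL' (m : ℕ) :
    Disjoint ((Finset.range m).image fun j => lineL m j)
      ((Finset.range m).image fun k => lineL' m k) := by
  simp only [Finset.disjoint_left, Finset.mem_image, not_exists, not_and]
  rintro _ ⟨j, -, rfl⟩ k - h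
  have hk : ![0, 0, 1] ∈ lineL' m k := by simp [mem_lineL']
  rw [h] at hk
  simp [mem_lineL] at hk

theorem card_boro {m : ℕ} (hm : m ≠ 0) : (boro m).card = 2 * m := by
  rw [boro, Finset.card_union_of_disjoint (disjoint_image_lineL_lineL' m),
    Finset.card_image_of_injOn (lineL_injOn m), Finset.card_image_of_injOn (lineL'_injOn hm),
    Finset.card_range]
  ring

theorem multAt_boro {m : ℕ} (hm : m ≠ 0) (P : Pt ℝ) : multAt (boro m) P =
    ((Finset.range m).filter fun j => P.submodule ≤ lineL m j).card +
      ((Finset.range m).filter fun k => P.submodule ≤ lineL' m k).card := by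
  rw [multAt, boro, Finset.filter_union, Finset.card_union_of_disjoint
    (Finset.disjoint_filter_filter (disjoint_image_lineL_lineL' m)), Finset.filter_image,
    Finset.filter_image,
    Finset.card_image_of_injOn ((lineL_injOn m).mono (Finset.filter_subset _ _)),
    Finset.card_image_of_injOn ((lineL'_injOn hm).mono (Finset.filter_subset _ _))]

theorem mem_lineL'_of_modEq {m : ℕ} (hm : m ≠ 0) {k l : ℕ} (h : k ≡ l [MOD m])
    {v : Fin 3 → ℝ} (hv : v ∈ lineL' m l) : v ∈ lineL' m k := by
  rw [← sin_mul_cos_sub_eq_zero_iff hm] at h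
  rw [mem_lineL'] at *
  linear_combination
    (Real.cos (Real.pi * k / m) * Real.cos (Real.pi * l / m) +
      Real.sin (Real.pi * k / m) * Real.sin (Real.pi * l / m)) * hv +
    (v 0 * Real.cos (Real.pi * l / m) + v 1 * Real.sin (Real.pi * l / m)) * h -
    (Real.sin (Real.pi * k / m) * v 0 - Real.cos (Real.pi * k / m) * v 1) *
      Real.sin_sq_add_cos_sq (Real.pi * l / m)

/-- `L_i`, `L_j` and `L'_{i+j}` are concurrent. -/
theorem mem_lineL_iff_mem_lineL' {m i j k : ℕ} (hi : i < m) (hj : j < m) (hij : i ≠ j)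
    (hk : k ≡ i + j [MOD m]) {v : Fin 3 → ℝ} (hv : v ∈ lineL m j) :
    v ∈ lineL m i ↔ v ∈ lineL' m k := by
  have hm : m ≠ 0 := by omega
  have hsin : Real.sin (Real.pi * i / m) * Real.cos (Real.pi * j / m) -
      Real.cos (Real.pi * i / m) * Real.sin (Real.pi * j / m) ≠ 0 := fun h =>
    hij (((sin_mul_cos_sub_eq_zero_iff hm i j).1 h).eq_of_lt_of_lt hi hj)
  have hk' : v ∈ lineL' m k ↔ v ∈ lineL' m (i + j) :=
    ⟨mem_lineL'_of_modEq hm hk.symm, mem_lineL'_of_modEq hm hk⟩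
  rw [hk', mem_lineL, mem_lineL']
  rw [mem_lineL] at hv
  have hdouble : ∀ n : ℕ, 2 * Real.pi * n / m = 2 * (Real.pi * n / m) := fun n => by ring
  have hadd : Real.pi * ((i + j : ℕ) : ℝ) / m = Real.pi * i / m + Real.pi * j / m := by
    push_cast; ring
  rw [hdouble, Real.cos_two_mul, Real.sin_two_mul] at hv ⊢
  rw [hadd, Real.sin_add, Real.cos_add]
  have ha := Real.sin_sq_add_cos_sq (Real.pi * i / m)
  have hb := Real.sin_sq_add_cos_sq (Real.pi * j / m)
  generalize Real.sin (Real.pi * i / m) = s at *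
  generalize Real.cos (Real.pi * i / m) = c at *
  generalize Real.sin (Real.pi * j / m) = t at *
  generalize Real.cos (Real.pi * j / m) = d at *
  have key : (2 * c ^ 2 - 1) * v 0 + 2 * s * c * v 1 + v 2 =
      -2 * (s * d - c * t) * ((s * d + c * t) * v 0 - (c * d - s * t) * v 1) := by
    have h1 : s ^ 2 = 1 - c ^ 2 := by linear_combination ha
    have h2 : t ^ 2 = 1 - d ^ 2 := by linear_combination hb
    linear_combination hv + v 0 * (2 * d ^ 2 * h1 - 2 * c ^ 2 * h2) +
      v 1 * (2 * t * d * ha - 2 * s * c * hb)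
  rw [key]
  simp [hsin]

theorem eq_tangencyPt {m j : ℕ} {P : Pt ℝ} (hL : P.submodule ≤ lineL m j)
    (hL' : P.submodule ≤ lineL' m (2 * j % m)) (hm : m ≠ 0) : P = tangencyPt m j := by
  rw [submodule_le_iff_rep_mem] at hL hL'
  replace hL' := mem_lineL'_of_modEq hm (Nat.mod_modEq (2 * j) m).symm hL'
  have h : Real.pi * ((2 * j : ℕ) : ℝ) / m = 2 * Real.pi * j / m := by push_cast; ring
  rw [mem_lineL', h] at hL'
  rw [mem_lineL] at hL
  have hsq := Real.sin_sq_add_cos_sq (2 * Real.pi * j / m)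
  rw [← P.mk_rep, tangencyPt, Projectivization.mk_eq_mk_iff']
  refine ⟨-P.rep 2, ?_⟩
  ext n
  fin_cases n
  · simp only [tangencyVec, Fin.zero_eta, Pi.smul_apply, smul_eq_mul, Matrix.cons_val_zero]
    linear_combination P.rep 0 * hsq - Real.sin (2 * Real.pi * j / m) * hL' -
      Real.cos (2 * Real.pi * j / m) * hL
  · simp only [tangencyVec, Fin.mk_one, Pi.smul_apply, smul_eq_mul, Matrix.cons_val_one,
      Matrix.cons_val_zero]
    linear_combination P.rep 1 * hsq + Real.cos (2 * Real.pi * j / m) * hL' -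
      Real.sin (2 * Real.pi * j / m) * hL
  · simp [tangencyVec]

theorem tangencyPt_mem_Sing2Set {m j : ℕ} (hj : j < m) : tangencyPt m j ∈ Sing2Set (boro m) := by
  have hm : m ≠ 0 := by omega
  have hS : ((Finset.range m).filter fun i => (tangencyPt m j).submodule ≤ lineL m i) = {j} := by
    ext i
    simp only [Finset.mem_filter, Finset.mem_range, Finset.mem_singleton, tangencyPt_le_iff]
    constructor
    · rintro ⟨hi, h⟩
      exact (tangencyVec_mem_lineL_iff hi hj).1 h
    · rintro rfl
      exact ⟨hj, (tangencyVec_mem_lineL_iff hj hj).2 rfl⟩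
  have hT : ((Finset.range m).filter fun k => (tangencyPt m j).submodule ≤ lineL' m k) =
      {2 * j % m} := by
    ext k
    simp only [Finset.mem_filter, Finset.mem_range, Finset.mem_singleton, tangencyPt_le_iff,
      tangencyVec_mem_lineL'_iff hm]
    constructor
    · rintro ⟨hk, h⟩
      rw [← Nat.mod_eq_of_lt hk]
      exact h
    · rintro rfl
      exact ⟨Nat.mod_lt _ (by omega), Nat.mod_modEq _ _⟩
  rw [Sing2Set, Set.mem_ofPred_eq, multAt_boro hm, hS, hT]
  simp

theorem le_lineL'_of_mem_Sing2Set {m j : ℕ} (hj : j < m) {P : Pt ℝ}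
    (hP : P ∈ Sing2Set (boro m)) (hL : P.submodule ≤ lineL m j) :
    P.submodule ≤ lineL' m (2 * j % m) := by
  have hm : m ≠ 0 := by omega
  rw [Sing2Set, Set.mem_ofPred_eq, multAt_boro hm] at hP
  set S := (Finset.range m).filter fun i => P.submodule ≤ lineL m i with hS
  set T := (Finset.range m).filter fun k => P.submodule ≤ lineL' m k with hT
  simp only [submodule_le_iff_rep_mem] at hS hT hL ⊢
  have hjS : j ∈ S := by simp [hS, hj, hL]
  have honly : ∀ i ∈ S, i = j := by
    intro i hiS
    by_contra hij
    have hi : i < m ∧ P.rep ∈ lineL m i := by simpa [hS] using hiS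
    have hkT : (i + j) % m ∈ T := by
      simp only [hT, Finset.mem_filter, Finset.mem_range]
      exact ⟨Nat.mod_lt _ (by omega),
        (mem_lineL_iff_mem_lineL' hi.1 hj hij (Nat.mod_modEq _ _) hL).1 hi.2⟩
    have h1 : 1 < S.card := Finset.one_lt_card.2 ⟨i, hiS, j, hjS, hij⟩
    have h2 : 0 < T.card := Finset.card_pos.2 ⟨_, hkT⟩
    omega
  have hS1 : S.card = 1 := Finset.card_eq_one.2 ⟨j, Finset.eq_singleton_iff_unique_mem.2
    ⟨hjS, honly⟩⟩
  obtain ⟨k, hkT⟩ : T.Nonempty := Finset.card_pos.1 (by omega)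
  have hk : k < m ∧ P.rep ∈ lineL' m k := by simpa [hT] using hkT
  have hi : (k + (m - j)) % m < m := Nat.mod_lt _ (by omega)
  have hik : k ≡ (k + (m - j)) % m + j [MOD m] := by
    have h : (k + (m - j)) % m + j ≡ k + (m - j) + j [MOD m] :=
      (Nat.mod_modEq _ _).add_right _
    rw [show k + (m - j) + j = k + m by omega] at h
    exact (h.trans (by simp [Nat.ModEq])).symm
  have hij : (k + (m - j)) % m = j := by
    by_contra hij
    refine hij (honly _ ?_)
    simp only [hS, Finset.mem_filter, Finset.mem_range]
    exact ⟨hi, (mem_lineL_iff_mem_lineL' hi hj hij hik hL).2 hk.2⟩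
  rw [hij, ← two_mul] at hik
  exact mem_lineL'_of_modEq hm ((Nat.mod_modEq _ _).trans hik.symm) hk.2

theorem exists_le_lineL_of_mem_Sing2Set {m : ℕ} (hm : 3 ≤ m) {P : Pt ℝ}
    (hP : P ∈ Sing2Set (boro m)) : ∃ j < m, P.submodule ≤ lineL m j := by
  by_contra! hL
  have hm0 : m ≠ 0 := by omega
  rw [Sing2Set, Set.mem_ofPred_eq, multAt_boro hm0, Finset.card_eq_zero.2
    (Finset.filter_eq_empty_iff.2 fun j hj => hL j (Finset.mem_range.1 hj)), zero_add] at hP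
  obtain ⟨k, hk, l, hl, hkl⟩ := Finset.one_lt_card.1 (hP ▸ one_lt_two)
  simp only [Finset.mem_filter, Finset.mem_range, submodule_le_iff_rep_mem, mem_lineL'] at hk hl
  have hsin : Real.sin (Real.pi * k / m) * Real.cos (Real.pi * l / m) -
      Real.cos (Real.pi * k / m) * Real.sin (Real.pi * l / m) ≠ 0 := fun h =>
    hkl (((sin_mul_cos_sub_eq_zero_iff hm0 k l).1 h).eq_of_lt_of_lt hk.1 hl.1)
  have h0 : P.rep 0 = 0 := (mul_eq_zero.1 (by
    linear_combination Real.cos (Real.pi * l / m) * hk.2 -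
      Real.cos (Real.pi * k / m) * hl.2)).resolve_left hsin
  have h1 : P.rep 1 = 0 := (mul_eq_zero.1 (by
    linear_combination Real.sin (Real.pi * l / m) * hk.2 -
      Real.sin (Real.pi * k / m) * hl.2)).resolve_left hsin
  rw [Finset.filter_true_of_mem fun n _ => by
    simp [submodule_le_iff_rep_mem, mem_lineL', h0, h1], Finset.card_range] at hP
  omega

theorem Sing2Set_boro {m : ℕ} (hm : 3 ≤ m) :
    Sing2Set (boro m) = tangencyPt m '' (Finset.range m : Set ℕ) := by
  ext P
  simp only [Set.mem_image, Finset.coe_range, Set.mem_Iio]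
  constructor
  · intro hP
    obtain ⟨j, hj, hL⟩ := exists_le_lineL_of_mem_Sing2Set hm hP
    exact ⟨j, hj, (eq_tangencyPt hL (le_lineL'_of_mem_Sing2Set hj hP hL) (by omega)).symm⟩
  · rintro ⟨j, hj, rfl⟩
    exact tangencyPt_mem_Sing2Set hj

theorem tangencyPt_injOn (m : ℕ) : Set.InjOn (tangencyPt m) (Finset.range m) := by
  intro i hi j hj h
  simp only [Finset.coe_range, Set.mem_Iio] at hi hj
  rw [← tangencyVec_mem_lineL_iff hi hj, ← tangencyPt_le_iff, ← h, tangencyPt_le_iff,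
    tangencyVec_mem_lineL_iff hi hi]

/-- For `m ≥ 3`, each line `L_j` of the Böröczky arrangement `𝒜_{2m}` contains
exactly one simple point, namely the intersection point of `L_j` and `L'_{2j mod m}`;
consequently `|Sing₂(𝒜_{2m})| = m = |𝒜_{2m}| / 2`. -/
theorem boroczky_simple_points (m : ℕ) (hm : 3 ≤ m) :
    (∀ j < m, ∃! P : Pt ℝ, P ∈ Sing2Set (boro m) ∧ P.submodule ≤ lineL m j) ∧
    (∀ j < m, ∀ P : Pt ℝ, P ∈ Sing2Set (boro m) → P.submodule ≤ lineL m j →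
      P.submodule ≤ lineL' m ((2 * j) % m)) ∧
    (Sing2Set (boro m)).ncard = m ∧
    2 * m = (boro m).card := by
  have hm0 : m ≠ 0 := by omega
  refine ⟨fun j hj => ⟨tangencyPt m j, ⟨tangencyPt_mem_Sing2Set hj, ?_⟩, ?_⟩,
    fun j hj P hP hL => le_lineL'_of_mem_Sing2Set hj hP hL, ?_, (card_boro hm0).symm⟩
  · exact (tangencyPt_le_iff m j _).2 ((tangencyVec_mem_lineL_iff hj hj).2 rfl)
  · rintro P ⟨hP, hL⟩
    exact eq_tangencyPt hL (le_lineL'_of_mem_Sing2Set hj hP hL) hm0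
  · rw [Sing2Set_boro hm, (tangencyPt_injOn m).ncard_image, Set.ncard_coe_finset,
      Finset.card_range]
end
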